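/- Let E be a non-trivial regular equational theory and let σ, θ be substitutions such that σ ≤_E^V θ and Var(σ(x)) = {x} holds for all x ∈ Dom(σ) \ Dom(θ). Then there is a substitution σ' such that σ ∼_E^V σ' and Dom(σ') ∪ VRan(σ') ⊆ Dom(θ) ∪ VRan(θ). -/

import Mathlib

namespace UnifFW

/-- First-order terms over a signature `F` (an arity-indexed family of function
symbols), with variables from the countably infinite set `V = ℕ`. -/
inductive Term (F : ℕ → Type) : Type
  | var : ℕ → Term F
  | app : (n : ℕ) → F n → (Fin n → Term F) → Term F

variable {F : ℕ → Type}

/-- The set of variables occurring in a term. -/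
def Term.vars : Term F → Set ℕ
  | .var x => {x}
  | .app _ _ ts => ⋃ i, (ts i).vars

/-- Homomorphic extension of a map `V → T(Σ,V)` to terms. -/
def Term.subst (σ : ℕ → Term F) : Term F → Term F
  | .var x => σ x
  | .app n f ts => .app n f (fun i => (ts i).subst σ)

/-- The congruence `≈_E` induced by a set `E` of identities: the smallest
equivalence relation containing all substitution instances of identities of `E`
and compatible with the term constructors. -/
inductive EqE (E : Set (Term F × Term F)) : Term F → Term F → Prop
  | ax {s t : Term F} (σ : ℕ → Term F) : (s, t) ∈ E → EqE E (s.subst σ) (t.subst σ)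
  | refl (t : Term F) : EqE E t t
  | symm {s t : Term F} : EqE E s t → EqE E t s
  | trans {s t u : Term F} : EqE E s t → EqE E t u → EqE E s u
  | congr {n : ℕ} (f : F n) {ts us : Fin n → Term F} :
      (∀ i, EqE E (ts i) (us i)) → EqE E (.app n f ts) (.app n f us)

/-- A theory is non-trivial if distinct variables are not equated. -/
def NonTrivial (E : Set (Term F × Term F)) : Prop :=
  ∀ x y : ℕ, x ≠ y → ¬ EqE E (.var x) (.var y)

/-- A theory is regular if both sides of each identity have the same variables. -/
def Regular (E : Set (Term F × Term F)) : Prop :=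
  ∀ p ∈ E, (Prod.fst p).vars = (Prod.snd p).vars

/-- A substitution: a map `V → T(Σ,V)` with finite domain. -/
structure Subst (F : ℕ → Type) where
  toFun : ℕ → Term F
  finite_dom : {x : ℕ | toFun x ≠ Term.var x}.Finite

/-- The domain of a substitution. -/
def Subst.Dom (σ : Subst F) : Set ℕ := {x : ℕ | σ.toFun x ≠ Term.var x}

/-- The variable range of a substitution: all variables occurring in the images
of domain variables. -/
def Subst.VRan (σ : Subst F) : Set ℕ := ⋃ x ∈ σ.Dom, (σ.toFun x).vars

/-- The instantiation preorder `σ ≤_E^X θ`: some substitution `λ` satisfies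
`λ(σ(x)) ≈_E θ(x)` for all `x ∈ X`. -/
def InstLE (E : Set (Term F × Term F)) (X : Set ℕ) (σ θ : Subst F) : Prop :=
  ∃ lam : Subst F, ∀ x ∈ X, EqE E ((σ.toFun x).subst lam.toFun) (θ.toFun x)

/-- The equivalence `σ ∼_E^X θ` induced by the instantiation preorder. -/
def InstEquiv (E : Set (Term F × Term F)) (X : Set ℕ) (σ θ : Subst F) : Prop :=
  InstLE E X σ θ ∧ InstLE E X θ σ

/-- The strict instantiation order `σ <_E^X θ`. -/
def InstLT (E : Set (Term F × Term F)) (X : Set ℕ) (σ θ : Subst F) : Prop :=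
  InstLE E X σ θ ∧ ¬ InstLE E X θ σ

/-- The set of variables occurring in a unification problem. -/
def VarsP (Γ : Set (Term F × Term F)) : Set ℕ :=
  ⋃ p ∈ Γ, (Prod.fst p).vars ∪ (Prod.snd p).vars

/-- `σ` is an `E`-unifier of the unification problem `Γ`. -/
def Unifier (E Γ : Set (Term F × Term F)) (σ : Subst F) : Prop :=
  ∀ p ∈ Γ, EqE E ((Prod.fst p).subst σ.toFun) ((Prod.snd p).subst σ.toFun)

/-- A unification problem is solvable if it has a unifier. -/
def Solvable (E Γ : Set (Term F × Term F)) : Prop := ∃ σ : Subst F, Unifier E Γ σ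

/-- `S` is a complete set of `E`-unifiers of `Γ` w.r.t. `≤_E^X`. -/
def CompleteSet (E Γ : Set (Term F × Term F)) (X : Set ℕ) (S : Set (Subst F)) : Prop :=
  (∀ σ ∈ S, Unifier E Γ σ) ∧ ∀ θ : Subst F, Unifier E Γ θ → ∃ σ ∈ S, InstLE E X σ θ

/-- `S` is a minimal complete set of `E`-unifiers of `Γ` w.r.t. `≤_E^X`:
complete, and no two distinct elements are comparable. -/
def MinimalComplete (E Γ : Set (Term F × Term F)) (X : Set ℕ) (S : Set (Subst F)) : Prop :=
  CompleteSet E Γ X S ∧ ∀ σ ∈ S, ∀ θ ∈ S, σ ≠ θ → ¬ InstLE E X σ θ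

/-- `Γ` has unification type unitary w.r.t. `≤_E^X`. -/
def TypeUnitary (E Γ : Set (Term F × Term F)) (X : Set ℕ) : Prop :=
  ∃ σ : Subst F, MinimalComplete E Γ X {σ}

/-- `Γ` has unification type finitary w.r.t. `≤_E^X`. -/
def TypeFinitary (E Γ : Set (Term F × Term F)) (X : Set ℕ) : Prop :=
  ∃ S : Set (Subst F), MinimalComplete E Γ X S ∧ S.Finite ∧ 1 < S.ncard

/-- `Γ` has unification type infinitary w.r.t. `≤_E^X`. -/
def TypeInfinitary (E Γ : Set (Term F × Term F)) (X : Set ℕ) : Prop :=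
  ∃ S : Set (Subst F), MinimalComplete E Γ X S ∧ S.Infinite

/-- `Γ` has unification type zero w.r.t. `≤_E^X`. -/
def TypeZero (E Γ : Set (Term F × Term F)) (X : Set ℕ) : Prop :=
  ¬ ∃ S : Set (Subst F), MinimalComplete E Γ X S

/-- `σ` is a `≤_E^X`-minimal `E`-unifier of `Γ`. -/
def MinUnifier (E Γ : Set (Term F × Term F)) (X : Set ℕ) (σ : Subst F) : Prop :=
  Unifier E Γ σ ∧ ∀ θ : Subst F, Unifier E Γ θ → InstLE E X θ σ → InstLE E X σ θ

/-- The set `C_E(Γ)` of unifiers all of whose range variables occur in the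
images of at least two distinct variables. -/
def CSet (E Γ : Set (Term F × Term F)) : Set (Subst F) :=
  {σ : Subst F | Unifier E Γ σ ∧
    ∀ y ∈ σ.VRan, ∃ x x' : ℕ, x ≠ x' ∧ y ∈ (σ.toFun x).vars ∩ (σ.toFun x').vars}

/-- `E` is Noetherian w.r.t. the unrestricted instantiation preorder: there is
no infinite strictly descending chain `σ₁ >_E^V σ₂ >_E^V ⋯`. -/
def Noetherian (E : Set (Term F × Term F)) : Prop :=
  ¬ ∃ f : ℕ → Subst F, ∀ n : ℕ, InstLT E Set.univ (f (n + 1)) (f n)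


theorem Term.vars_subst (σ : ℕ → Term F) (t : Term F) :
    (t.subst σ).vars = ⋃ y ∈ t.vars, (σ y).vars := by
  induction t with
  | var x => simp [Term.subst, Term.vars]
  | app n f ts ih => simp only [Term.subst, Term.vars, ih, Set.biUnion_iUnion]

theorem Term.subst_congr {σ τ : ℕ → Term F} {t : Term F}
    (h : ∀ y ∈ t.vars, σ y = τ y) : t.subst σ = t.subst τ := by
  induction t with
  | var x => exact h x rfl
  | app n f ts ih =>
    simp only [Term.subst]
    congr 1
    funext i
    exact ih i fun y hy => h y (Set.mem_iUnion.2 ⟨i, hy⟩)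

theorem Term.subst_var (t : Term F) : t.subst Term.var = t := by
  induction t with
  | var x => rfl
  | app n f ts ih => simp only [Term.subst, ih]

theorem Regular.vars_eq {E : Set (Term F × Term F)} (hreg : Regular E) {s t : Term F}
    (h : EqE E s t) : s.vars = t.vars := by
  induction h with
  | ax σ hst => rw [Term.vars_subst, Term.vars_subst, hreg _ hst]
  | refl t => rfl
  | symm _ ih => exact ih.symm
  | trans _ _ ih₁ ih₂ => exact ih₁.trans ih₂
  | congr f _ ih => simp only [Term.vars, ih]

open Classical in
/-- The substitution that agrees with `σ` on `W` and is the identity elsewhere. -/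
noncomputable def Subst.restrict (σ : Subst F) (W : Set ℕ) : Subst F where
  toFun x := if x ∈ W then σ.toFun x else .var x
  finite_dom := σ.finite_dom.subset fun x hx => by
    by_cases h : x ∈ W <;> simp_all

theorem Subst.restrict_of_mem (σ : Subst F) {W : Set ℕ} {x : ℕ} (h : x ∈ W) :
    (σ.restrict W).toFun x = σ.toFun x := if_pos h

theorem Subst.restrict_of_notMem (σ : Subst F) {W : Set ℕ} {x : ℕ} (h : x ∉ W) :
    (σ.restrict W).toFun x = .var x := if_neg h

/-- A substitution restricted to the complement of `W` fixes every term over `W`. -/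
theorem Subst.subst_restrict_compl (σ : Subst F) {W : Set ℕ} {t : Term F} (h : t.vars ⊆ W) :
    t.subst (σ.restrict Wᶜ).toFun = t :=
  (Term.subst_congr fun _ hy => σ.restrict_of_notMem (Set.notMem_compl_iff.2 (h hy))).trans
    t.subst_var

/-- Lemma `regular:theory:main:lem`: for a non-trivial
regular theory `E` and substitutions `σ ≤_E^V θ` such that `Var(σ(x)) = {x}`
for all `x ∈ Dom(σ) \ Dom(θ)`, there is a substitution `σ'` with
`σ ∼_E^V σ'` and `Dom(σ') ∪ VRan(σ') ⊆ Dom(θ) ∪ VRan(θ)`. -/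
theorem stmt11 {F : ℕ → Type} (E : Set (Term F × Term F)) (hE : NonTrivial E)
    (hreg : Regular E) (σ θ : Subst F) (h : InstLE E Set.univ σ θ)
    (hvars : ∀ x ∈ σ.Dom \ θ.Dom, (σ.toFun x).vars = {x}) :
    ∃ σ' : Subst F, InstEquiv E Set.univ σ σ' ∧
      σ'.Dom ∪ σ'.VRan ⊆ θ.Dom ∪ θ.VRan := by
  obtain ⟨lam, hlam⟩ := h
  have hσ : ∀ x, x ∉ θ.Dom → (σ.toFun x).vars = {x} := fun x hx => by
    by_cases hxσ : x ∈ σ.Dom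
    · exact hvars x ⟨hxσ, hx⟩
    · rw [not_not.1 hxσ, Term.vars]
  have hθ : ∀ x, x ∉ θ.Dom → θ.toFun x = .var x := fun x hx => not_not.1 hx
  have hlamvars : ∀ x, x ∉ θ.Dom → (lam.toFun x).vars = {x} := fun x hx => by
    have := hreg.vars_eq (hlam x trivial)
    rwa [Term.vars_subst, hσ x hx, Set.biUnion_singleton, hθ x hx, Term.vars] at this
  set W : Set ℕ := θ.Dom ∪ θ.VRan
  have hσW : ∀ x ∈ W, (σ.toFun x).vars ⊆ W := fun x hxW y hy => by
    by_cases hx : x ∈ θ.Dom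
    · by_cases hyD : y ∈ θ.Dom
      · exact Or.inl hyD
      · refine Or.inr (Set.mem_biUnion hx ?_)
        rw [← hreg.vars_eq (hlam x trivial), Term.vars_subst]
        exact Set.mem_biUnion hy (by rw [hlamvars y hyD]; rfl)
    · rw [hσ x hx] at hy
      exact hy ▸ hxW
  have hdom : (σ.restrict W).Dom ⊆ W := fun x hx => by
    by_contra hxW
    exact hx (σ.restrict_of_notMem hxW)
  refine ⟨σ.restrict W, ⟨⟨lam.restrict Wᶜ, fun x _ => ?_⟩, ⟨σ.restrict Wᶜ, fun x _ => ?_⟩⟩, ?_⟩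
  · by_cases hx : x ∈ W
    · rw [lam.subst_restrict_compl (hσW x hx), σ.restrict_of_mem hx]
      exact .refl _
    · have hxD : x ∉ θ.Dom := fun h => hx (Or.inl h)
      have heq : (σ.toFun x).subst (lam.restrict Wᶜ).toFun = (σ.toFun x).subst lam.toFun :=
        Term.subst_congr fun y hy => by
          rw [hσ x hxD] at hy
          exact lam.restrict_of_mem (hy ▸ hx)
      rw [heq, σ.restrict_of_notMem hx, ← hθ x hxD]
      exact hlam x trivial
  · by_cases hx : x ∈ W
    · rw [σ.restrict_of_mem hx, σ.subst_restrict_compl (hσW x hx)]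
      exact .refl _
    · rw [σ.restrict_of_notMem hx, Term.subst, σ.restrict_of_mem hx]
      exact .refl _
  · refine Set.union_subset hdom (Set.iUnion₂_subset fun x hx => ?_)
    rw [σ.restrict_of_mem (hdom hx)]
    exact hσW x (hdom hx)
end UnifFW
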